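/- Let (B^H_t)_{t≥0} be a fractional Brownian motion with Hurst parameter H ∈ (0, 3/4) on a probability space (Ω, F, P), let σ > 0 and S_0 > 0, and define the stock price S_t = S_0 · exp(σ B^H_t − (1/2) σ² t^{2H}). For N ≥ 1 define the quadratic-variation estimator σ̂²_N = N^{2H−1} Σ_{k=0}^{N−1} ( log S_{(k+1)/N} − log S_{k/N} )². Then √N (σ̂²_N − σ²) converges in distribution, as N → ∞, to a centered normal law N(0, σ²_{H,2}) with variance σ²_{H,2} = 2σ⁴ (1 + 2 Σ_{k=1}^∞ ρ_H(k)²), where ρ_H(k) = (1/2)((k+1)^{2H} + (k−1)^{2H} − 2 k^{2H}). -/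

import Mathlib

open MeasureTheory ProbabilityTheory Filter Topology NNReal BoundedContinuousFunction

/-- The fourth moment of the standard Gaussian distribution is `3`. -/
lemma integral_pow_four_gaussianReal : ∫ x, x ^ 4 ∂gaussianReal 0 1 = 3 := by
  have h := iteratedDeriv_mgf_zero (X := id) (μ := gaussianReal 0 1) (by simp) 4
  rw [mgf_id_gaussianReal] at h
  have key (p p' : ℝ → ℝ) (hp : ∀ t, HasDerivAt p (p' t) t) :
      deriv (fun t ↦ p t * Real.exp (t ^ 2 / 2)) =
        fun t ↦ (p' t + p t * t) * Real.exp (t ^ 2 / 2) := by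
    funext t
    have he : HasDerivAt (fun t : ℝ ↦ Real.exp (t ^ 2 / 2)) (Real.exp (t ^ 2 / 2) * t) t := by
      simpa using ((hasDerivAt_pow 2 t).div_const 2).exp
    rw [((hp t).fun_mul he).deriv]
    ring
  have e0 : (fun t : ℝ ↦ Real.exp (0 * t + ((1 : ℝ≥0) : ℝ) * t ^ 2 / 2)) =
      fun t ↦ (fun _ ↦ (1 : ℝ)) t * Real.exp (t ^ 2 / 2) := by
    funext t; simp
  rw [e0, iteratedDeriv_eq_iterate] at h
  simp only [Function.iterate_succ, Function.iterate_zero, Function.comp_apply, id] at h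
  rw [key _ (fun _ ↦ 0) (fun t ↦ hasDerivAt_const t 1),
    key _ (fun _ ↦ 1) (fun t ↦ by simpa using hasDerivAt_id' t),
    key _ (fun t ↦ 2 * t) (fun t ↦ by
      simpa using (((hasDerivAt_id' t).mul (hasDerivAt_id' t)).const_add 1).congr_deriv (by ring)),
    key _ (fun t ↦ 3 + 3 * t ^ 2) (fun t ↦ by
      have h := (((hasDerivAt_id' t).const_mul 2).fun_add
        ((((hasDerivAt_id' t).fun_mul (hasDerivAt_id' t)).const_add 1).fun_mul (hasDerivAt_id' t)))
      exact (h.congr_deriv (by ring)).congr_of_eventuallyEq (.of_forall fun x ↦ by simp))] at h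
  simpa using h.symm

lemma integral_sq_gaussianReal : ∫ x, x ^ 2 ∂gaussianReal 0 1 = 1 := by
  have h := variance_id_gaussianReal (μ := 0) (v := 1)
  rw [variance_of_integral_eq_zero (by fun_prop) (by simp)] at h
  simpa using h

lemma integrable_pow_gaussianReal (n : ℕ) : Integrable (fun x ↦ x ^ n) (gaussianReal 0 1) := by
  by_cases hn : n = 0
  · simp [hn]
  have h := (memLp_id_gaussianReal (μ := 0) (v := 1) n).integrable_norm_pow hn
  refine (integrable_norm_iff (by fun_prop)).1 ?_
  simpa using h

/-- The characteristic function of `ξ ^ 2 - 1` for a standard Gaussian variable `ξ`. -/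
noncomputable def centeredSqCharFun (s : ℝ) : ℂ :=
  charFun ((gaussianReal 0 1).map (fun x ↦ x ^ 2 - 1)) s

lemma norm_centeredSqCharFun_le_one (s : ℝ) : ‖centeredSqCharFun s‖ ≤ 1 := by
  have : IsProbabilityMeasure ((gaussianReal 0 1).map (fun x : ℝ ↦ x ^ 2 - 1)) :=
    Measure.isProbabilityMeasure_map (by fun_prop)
  exact norm_charFun_le_one s

lemma centeredSqCharFun_sub_isLittleO :
    (fun s : ℝ ↦ centeredSqCharFun s - (1 - s ^ 2)) =o[𝓝 0] fun s : ℝ ↦ s ^ 2 := by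
  have i2 := integrable_pow_gaussianReal 2
  have i4 := integrable_pow_gaussianReal 4
  have h0 : ∫ x, (√2)⁻¹ * (x ^ 2 - 1) ∂gaussianReal 0 1 = 0 := by
    rw [integral_const_mul, integral_sub i2 (integrable_const _), integral_sq_gaussianReal]
    simp
  have h1 : ∫ x, ((fun x ↦ (√2)⁻¹ * (x ^ 2 - 1)) ^ 2) x ∂gaussianReal 0 1 = 1 := by
    have : ∀ x : ℝ, ((fun x : ℝ ↦ (√2)⁻¹ * (x ^ 2 - 1)) ^ 2) x =
        2⁻¹ * (x ^ 4 - 2 * x ^ 2 + 1) := by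
      intro x
      simp only [Pi.pow_apply, mul_pow, inv_pow]
      rw [Real.sq_sqrt (by norm_num)]
      ring
    simp_rw [this]
    have i42 : Integrable (fun x : ℝ ↦ x ^ 4 - 2 * x ^ 2) (gaussianReal 0 1) :=
      i4.sub (i2.const_mul 2)
    rw [integral_const_mul, integral_add i42 (integrable_const _), integral_sub i4 (i2.const_mul 2),
      integral_const_mul, integral_sq_gaussianReal,
      integral_pow_four_gaussianReal]
    simp; norm_num
  have h := taylor_charFun_two (P := gaussianReal 0 1)
    (X := fun x ↦ (√2)⁻¹ * (x ^ 2 - 1)) (by fun_prop) h0 h1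
  have ht : Tendsto (fun s : ℝ ↦ √2 * s) (𝓝 0) (𝓝 0) := by
    simpa using (continuous_const_mul (√2)).tendsto (0 : ℝ)
  have h2 := h.comp_tendsto ht
  have h3 : (fun s : ℝ ↦ centeredSqCharFun s - (1 - s ^ 2)) =o[𝓝 0]
      fun s : ℝ ↦ 2 * s ^ 2 := by
    refine h2.congr (fun s ↦ ?_) (fun s ↦ ?_)
    · have h2' : ((√2 : ℝ) : ℂ) ^ 2 = 2 := by
        rw [← Complex.ofReal_pow, Real.sq_sqrt (by norm_num)]; simp
      simp only [Function.comp_apply, centeredSqCharFun]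
      rw [charFun_map_mul_comp (by fun_prop), inv_mul_cancel_left₀ (by positivity)]
      push_cast
      rw [mul_pow, h2']
      ring
    · simp [mul_pow]
  exact h3.trans_isBigO (Asymptotics.isBigO_const_mul_self _ _ _)

lemma exists_norm_centeredSqCharFun_sub_exp_le {ε : ℝ} (hε : 0 < ε) :
    ∃ δ > 0, ∀ s : ℝ, |s| ≤ δ →
      ‖centeredSqCharFun s - Complex.exp (-(s ^ 2 : ℝ))‖ ≤ ε * s ^ 2 := by
  have h1 : (fun s : ℝ ↦ (1 - s ^ 2 : ℂ) - Complex.exp (-(s ^ 2 : ℝ))) =o[𝓝 0]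
      fun s : ℝ ↦ s ^ 2 := by
    have h := (hasDerivAt_iff_isLittleO_nhds_zero.1 (Complex.hasDerivAt_exp 0))
    have ht : Tendsto (fun s : ℝ ↦ (-(s ^ 2 : ℝ) : ℂ)) (𝓝 0) (𝓝 0) := by
      have : Continuous (fun s : ℝ ↦ (-(s ^ 2 : ℝ) : ℂ)) := by fun_prop
      simpa using this.tendsto 0
    have h2 := (h.comp_tendsto ht).neg_left
    refine (h2.congr_left (fun s ↦ ?_)).trans_isBigO ?_
    · simp; ring
    · exact Asymptotics.IsBigO.of_norm_le (fun s ↦ by simp)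
  have h := (centeredSqCharFun_sub_isLittleO.add h1).def hε
  obtain ⟨δ, hδ, h⟩ := Metric.eventually_nhds_iff.1 h
  refine ⟨δ / 2, by positivity, fun s hs ↦ ?_⟩
  have := h (y := s) (by rw [Real.dist_0_eq_abs]; linarith)
  simpa using this

lemma norm_prod_sub_prod_le_sum {ι : Type*} (s : Finset ι) (f g : ι → ℂ)
    (hf : ∀ i, ‖f i‖ ≤ 1) (hg : ∀ i, ‖g i‖ ≤ 1) :
    ‖∏ i ∈ s, f i - ∏ i ∈ s, g i‖ ≤ ∑ i ∈ s, ‖f i - g i‖ := by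
  classical
  induction s using Finset.induction_on with
  | empty => simp
  | insert a s ha ih =>
    rw [Finset.prod_insert ha, Finset.prod_insert ha, Finset.sum_insert ha]
    have hp : ‖∏ i ∈ s, f i‖ ≤ 1 := by
      rw [norm_prod]
      exact Finset.prod_le_one (fun i _ ↦ norm_nonneg _) (fun i _ ↦ hf i)
    calc ‖f a * ∏ i ∈ s, f i - g a * ∏ i ∈ s, g i‖
        = ‖(f a - g a) * ∏ i ∈ s, f i + g a * (∏ i ∈ s, f i - ∏ i ∈ s, g i)‖ := by
          congr 1; ring
      _ ≤ ‖f a - g a‖ * ‖∏ i ∈ s, f i‖ + ‖g a‖ * ‖∏ i ∈ s, f i - ∏ i ∈ s, g i‖ := by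
          rw [← norm_mul, ← norm_mul]
          exact norm_add_le _ _
      _ ≤ ‖f a - g a‖ * 1 + 1 * ∑ i ∈ s, ‖f i - g i‖ := by
          gcongr
          exact hg a
      _ = _ := by ring

/-- Convergence of the characteristic functions of weighted sums of independent centered squares
of standard Gaussian variables, when the weights are uniformly negligible. -/
lemma tendsto_prod_centeredSqCharFun {ι : ℕ → Type*} [∀ n, Fintype (ι n)]
    (l : ∀ n, ι n → ℝ) (M : ℕ → ℝ) (hM : Tendsto M atTop (𝓝 0)) (hl : ∀ n i, |l n i| ≤ M n)
    {V : ℝ} (hV : Tendsto (fun n ↦ ∑ i, l n i ^ 2) atTop (𝓝 V)) :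
    Tendsto (fun n ↦ ∏ i, centeredSqCharFun (l n i)) atTop (𝓝 (Complex.exp (-V))) := by
  have hexp : Tendsto (fun n ↦ ∏ i, Complex.exp (-(l n i ^ 2 : ℝ))) atTop
      (𝓝 (Complex.exp (-V))) := by
    simp_rw [← Complex.exp_sum, Finset.sum_neg_distrib, ← Complex.ofReal_sum]
    exact (Complex.continuous_exp.tendsto _).comp
      ((Complex.continuous_ofReal.tendsto _).comp hV).neg
  have hdiff : Tendsto (fun n ↦ ∏ i, centeredSqCharFun (l n i) -
      ∏ i, Complex.exp (-(l n i ^ 2 : ℝ))) atTop (𝓝 0) := by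
    have hV0 : 0 ≤ V := ge_of_tendsto' hV fun n ↦ Finset.sum_nonneg fun i _ ↦ sq_nonneg _
    rw [Metric.tendsto_atTop']
    intro η hη
    obtain ⟨δ, hδ, h⟩ := exists_norm_centeredSqCharFun_sub_exp_le (ε := η / (2 * (V + 1)))
      (by positivity)
    have h1 : ∀ᶠ n in atTop, M n < δ := hM.eventually_lt_const hδ
    have h2 : ∀ᶠ n in atTop, ∑ i, l n i ^ 2 < V + 1 := hV.eventually_lt_const (by linarith)
    obtain ⟨N, hN⟩ := eventually_atTop.1 (h1.and h2)
    refine ⟨N, fun n hn ↦ ?_⟩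
    obtain ⟨hn1, hn2⟩ := hN n hn.le
    rw [dist_zero_right]
    calc _ ≤ ∑ i, ‖centeredSqCharFun (l n i) - Complex.exp (-(l n i ^ 2 : ℝ))‖ :=
          norm_prod_sub_prod_le_sum _ _ _ (fun i ↦ norm_centeredSqCharFun_le_one _) fun i ↦ by
            rw [← Complex.ofReal_neg, Complex.norm_exp_ofReal]
            exact Real.exp_le_one_iff.2 (neg_nonpos.2 (sq_nonneg _))
      _ ≤ ∑ i, η / (2 * (V + 1)) * l n i ^ 2 :=
          Finset.sum_le_sum fun i _ ↦ h _ ((hl n i).trans hn1.le)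
      _ = η / (2 * (V + 1)) * ∑ i, l n i ^ 2 := by rw [Finset.mul_sum]
      _ ≤ η / (2 * (V + 1)) * (V + 1) := by gcongr
      _ < η := by field_simp; linarith
  simpa using hdiff.add hexp

lemma charFun_map_sq_sub_gaussianReal (v : ℝ≥0) (s : ℝ) :
    charFun ((gaussianReal 0 v).map (fun x ↦ x ^ 2 - (v : ℝ))) s = centeredSqCharFun (s * v) := by
  have h : gaussianReal 0 v = (gaussianReal 0 1).map (fun x ↦ √v * x) := by
    rw [gaussianReal_map_const_mul]
    congr 1
    · simp
    · ext; simp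
  have h2 : (fun x ↦ x ^ 2 - (v : ℝ)) ∘ (fun x ↦ √v * x) = fun x ↦ (v : ℝ) * (x ^ 2 - 1) := by
    funext x
    simp only [Function.comp_apply, mul_pow, Real.sq_sqrt v.coe_nonneg]
    ring
  rw [h, Measure.map_map (by fun_prop) (by fun_prop), h2, charFun_map_mul_comp (by fun_prop),
    centeredSqCharFun, mul_comm]

section GaussianVector

variable {Ω : Type*} [MeasurableSpace Ω] {P : Measure Ω}

lemma integral_sum_mul_sum {ι : Type*} [Fintype ι] {X : ι → Ω → ℝ} {C : ι → ι → ℝ}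
    (hX : ∀ i, MemLp (X i) 2 P) (hC : ∀ i j, ∫ ω, X i ω * X j ω ∂P = C i j) (a b : ι → ℝ) :
    ∫ ω, (∑ i, a i * X i ω) * (∑ j, b j * X j ω) ∂P = ∑ i, ∑ j, a i * b j * C i j := by
  have hint : ∀ i j, Integrable (fun ω ↦ a i * X i ω * (b j * X j ω)) P := fun i j ↦
    ((hX i).const_mul (a i)).integrable_mul ((hX j).const_mul (b j))
  simp_rw [Finset.sum_mul_sum]
  rw [integral_finsetSum _ fun i _ ↦ integrable_finsetSum _ fun j _ ↦ hint i j]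
  refine Finset.sum_congr rfl fun i _ ↦ ?_
  rw [integral_finsetSum _ fun j _ ↦ hint i j]
  refine Finset.sum_congr rfl fun j _ ↦ ?_
  rw [← hC, ← integral_const_mul]
  congr 1 with ω
  ring

lemma abs_eigenvalues_le {ι : Type*} [Fintype ι] [DecidableEq ι] {C : Matrix ι ι ℝ}
    (hC : C.IsHermitian) {M : ℝ} (hM : ∀ i, ∑ j, |C i j| ≤ M) (i : ι) :
    |hC.eigenvalues i| ≤ M := by
  set b := hC.eigenvectorBasis i with hb
  have : Nonempty ι := ⟨i⟩
  obtain ⟨k, -, hk⟩ := Finset.exists_max_image Finset.univ (fun j ↦ |b j|) Finset.univ_nonempty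
  have hk0 : 0 < |b k| := by
    refine (abs_nonneg _).lt_of_ne' fun h0 ↦ ?_
    have : b = 0 := by
      ext j
      have := hk j (Finset.mem_univ j)
      rw [h0] at this
      simpa using this
    exact hC.eigenvectorBasis.orthonormal.ne_zero i this
  have h := congrFun (hC.mulVec_eigenvectorBasis i) k
  simp only [Matrix.mulVec, dotProduct, Pi.smul_apply, smul_eq_mul, ← hb] at h
  refine le_of_mul_le_mul_right ?_ hk0
  calc |hC.eigenvalues i| * |b k| = |∑ j, C k j * b j| := by rw [h, abs_mul]
    _ ≤ ∑ j, |C k j * b j| := Finset.abs_sum_le_sum_abs _ _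
    _ ≤ ∑ j, |C k j| * |b k| := Finset.sum_le_sum fun j _ ↦ by
        rw [abs_mul]
        exact mul_le_mul_of_nonneg_left (hk j (Finset.mem_univ j)) (abs_nonneg _)
    _ = (∑ j, |C k j|) * |b k| := by rw [Finset.sum_mul]
    _ ≤ M * |b k| := by gcongr; exact hM k

lemma sum_eigenvalues_sq {ι : Type*} [Fintype ι] [DecidableEq ι] {C : Matrix ι ι ℝ}
    (hC : C.IsHermitian) : ∑ i, hC.eigenvalues i ^ 2 = ∑ i, ∑ j, C i j ^ 2 := by
  set b := hC.eigenvectorBasis with hb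
  have h1 : ∀ i, hC.eigenvalues i ^ 2 = ∑ k, (∑ j, C k j * b i j) ^ 2 := by
    intro i
    have h (k : ι) : ∑ j, C k j * b i j = hC.eigenvalues i * b i k := by
      simpa [Matrix.mulVec, dotProduct, ← hb] using congrFun (hC.mulVec_eigenvectorBasis i) k
    have hn : ∑ k, b i k ^ 2 = 1 := by
      have := EuclideanSpace.real_norm_sq_eq (b i)
      rw [b.norm_eq_one] at this
      simpa using this.symm
    simp_rw [h, mul_pow, ← Finset.mul_sum, hn, mul_one]
  simp_rw [h1]
  rw [Finset.sum_comm]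
  refine Finset.sum_congr rfl fun k _ ↦ ?_
  have := b.sum_sq_norm_inner_right (WithLp.toLp 2 (C k))
  rw [EuclideanSpace.real_norm_sq_eq] at this
  simpa [PiLp.inner_apply, mul_comm] using this

/-- A quadratic form in a centered Gaussian vector, here the centered squared norm, has the law of a
weighted sum of independent centered squares of standard Gaussian variables, the weights being the
eigenvalues of the covariance matrix. -/
lemma charFun_map_sum_sq_sub [IsProbabilityMeasure P] {ι : Type*} [Fintype ι] [DecidableEq ι]
    {X : ι → Ω → ℝ}
    (hX : HasGaussianLaw (fun ω i ↦ X i ω) P) (h0 : ∀ i, ∫ ω, X i ω ∂P = 0) {C : Matrix ι ι ℝ}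
    (hC : ∀ i j, ∫ ω, X i ω * X j ω ∂P = C i j) (hH : C.IsHermitian) (s : ℝ) :
    charFun (P.map (fun ω ↦ ∑ i, (X i ω ^ 2 - C i i))) s =
      ∏ i, centeredSqCharFun (s * hH.eigenvalues i) := by
  set b := hH.eigenvectorBasis with hb
  set l := hH.eigenvalues with hl
  have hXm (i : ι) : MemLp (X i) 2 P := (hX.eval i).memLp_two
  let Y : ι → Ω → ℝ := fun i ω ↦ ∑ k, b i k * X k ω
  have hY : HasGaussianLaw (fun ω i ↦ Y i ω) P := by
    let L : (ι → ℝ) →L[ℝ] (ι → ℝ) :=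
      .pi fun i ↦ ∑ k, b i k • ContinuousLinearMap.proj (R := ℝ) (φ := fun _ : ι ↦ ℝ) k
    have hLY : (fun ω i ↦ Y i ω) = fun ω ↦ L (fun i ↦ X i ω) := by
      funext ω i
      simp [L, Y]
    rw [hLY]
    exact hX.map_fun L
  have hYm (i : ι) : MemLp (Y i) 2 P := (hY.eval i).memLp_two
  have hYmean (i : ι) : ∫ ω, Y i ω ∂P = 0 := by
    simp only [Y]
    rw [integral_finsetSum _ fun k _ ↦ ((hXm k).integrable one_le_two).const_mul _]
    simp [integral_const_mul, h0]
  have hYY (i j : ι) : ∫ ω, Y i ω * Y j ω ∂P = if i = j then l i else 0 := by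
    simp only [Y]
    rw [integral_sum_mul_sum hXm hC]
    have h (k : ι) : ∑ m, C k m * b j m = l j * b j k := by
      simpa [Matrix.mulVec, dotProduct, ← hb] using congrFun (hH.mulVec_eigenvectorBasis j) k
    have h2 : ∀ k, ∑ m, b i k * b j m * C k m = l j * (b i k * b j k) := fun k ↦ by
      rw [mul_left_comm, ← h, Finset.mul_sum]
      exact Finset.sum_congr rfl fun m _ ↦ by ring
    simp_rw [h2, ← Finset.mul_sum]
    have h3 : ∑ k, b i k * b j k = if i = j then 1 else 0 := by
      have := orthonormal_iff_ite.1 b.orthonormal i j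
      simpa [PiLp.inner_apply, mul_comm] using this
    rw [h3]
    split_ifs with hij <;> simp [hij]
  have hl0 (i : ι) : 0 ≤ l i := by
    have := hYY i i
    rw [if_pos rfl] at this
    rw [← this]
    exact integral_nonneg fun ω ↦ mul_self_nonneg _
  have hlaw (i : ι) : P.map (Y i) = gaussianReal 0 (l i).toNNReal := by
    rw [(hY.eval i).map_eq_gaussianReal, hYmean,
      variance_of_integral_eq_zero (hYm i).aemeasurable (hYmean i)]
    congr 2
    simpa [sq] using hYY i i
  have hindep : iIndepFun Y P := hY.iIndepFun_of_covariance_eq_zero fun i j hij ↦ by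
    rw [covariance_eq_sub (hYm i) (hYm j), hYmean, zero_mul, sub_zero]
    simpa [hij] using hYY i j
  have hindep2 : iIndepFun (fun i ω ↦ Y i ω ^ 2 - l i) P :=
    hindep.comp (fun i x ↦ x ^ 2 - l i) fun i ↦ by fun_prop
  have hsum (ω : Ω) : ∑ i, (X i ω ^ 2 - C i i) = ∑ i, (Y i ω ^ 2 - l i) := by
    have h1 : ∑ i, Y i ω ^ 2 = ∑ i, X i ω ^ 2 := by
      have := b.sum_sq_norm_inner_right (WithLp.toLp 2 (fun i ↦ X i ω))
      rw [EuclideanSpace.real_norm_sq_eq] at this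
      simpa [PiLp.inner_apply, Y, mul_comm] using this
    have h2 : ∑ i, C i i = ∑ i, l i := by
      simpa [Matrix.trace] using hH.trace_eq_sum_eigenvalues
    rw [Finset.sum_sub_distrib, Finset.sum_sub_distrib, h1, h2]
  simp_rw [hsum]
  rw [hindep2.charFun_map_fun_sum_eq_prod fun i ↦
    ((hYm i).aemeasurable.pow_const 2).sub_const _]
  rw [Finset.prod_apply]
  refine Finset.prod_congr rfl fun i _ ↦ ?_
  have hcomp : P.map (fun ω ↦ Y i ω ^ 2 - l i) = (P.map (Y i)).map (fun x ↦ x ^ 2 - l i) :=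
    (AEMeasurable.map_map_of_aemeasurable (g := fun x ↦ x ^ 2 - l i) (by fun_prop)
      (hYm i).aemeasurable).symm
  have := charFun_map_sq_sub_gaussianReal (l i).toNNReal s
  rw [Real.coe_toNNReal _ (hl0 i)] at this
  rw [hcomp, hlaw, this]

end GaussianVector

section Toeplitz

lemma sum_range_sum_range_natAbs_sub (g : ℕ → ℝ) (N : ℕ) :
    ∑ i ∈ Finset.range N, ∑ j ∈ Finset.range N, g ((i : ℤ) - j).natAbs =
      ∑ i ∈ Finset.range N, (g 0 + 2 * ∑ k ∈ Finset.range i, g (k + 1)) := by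
  induction N with
  | zero => simp
  | succ N ih =>
    have h1 : ∑ j ∈ Finset.range N, g ((N : ℤ) - j).natAbs = ∑ k ∈ Finset.range N, g (k + 1) := by
      rw [← Finset.sum_range_reflect]
      refine Finset.sum_congr rfl fun j hj ↦ ?_
      rw [Finset.mem_range] at hj
      congr 1
      omega
    have h2 : ∑ j ∈ Finset.range N, g ((j : ℤ) - N).natAbs =
        ∑ k ∈ Finset.range N, g (k + 1) := by
      rw [← h1]
      refine Finset.sum_congr rfl fun j _ ↦ ?_
      congr 1
      omega
    rw [Finset.sum_range_succ, Finset.sum_range_succ _ N]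
    simp_rw [Finset.sum_range_succ _ N]
    rw [Finset.sum_add_distrib, ih, h1, h2]
    simp
    ring

lemma sum_range_natAbs_sub_le {g : ℕ → ℝ} (hg : ∀ k, 0 ≤ g k) {N i : ℕ} (hi : i < N) :
    ∑ j ∈ Finset.range N, g ((i : ℤ) - j).natAbs ≤ 2 * ∑ k ∈ Finset.range N, g k := by
  have h1 : ∑ j ∈ Finset.range (i + 1), g ((i : ℤ) - j).natAbs =
      ∑ k ∈ Finset.range (i + 1), g k := by
    rw [← Finset.sum_range_reflect]
    refine Finset.sum_congr rfl fun j hj ↦ ?_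
    rw [Finset.mem_range] at hj
    congr 1
    omega
  have h2 : ∑ k ∈ Finset.range (N - (i + 1)), g ((i : ℤ) - (i + 1 + k : ℕ)).natAbs ≤
      ∑ k ∈ Finset.range N, g k := by
    calc _ = ∑ k ∈ Finset.range (N - (i + 1)), g (k + 1) := by
          refine Finset.sum_congr rfl fun k _ ↦ ?_
          congr 1
          omega
      _ ≤ ∑ k ∈ Finset.range (N - (i + 1)), g (k + 1) + g 0 := by linarith [hg 0]
      _ = ∑ k ∈ Finset.range (N - (i + 1) + 1), g k := (Finset.sum_range_succ' _ _).symm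
      _ ≤ _ := Finset.sum_le_sum_of_subset_of_nonneg
          (Finset.range_subset_range.2 (by omega)) fun k _ _ ↦ hg k
  have h3 : ∑ k ∈ Finset.range (i + 1), g k ≤ ∑ k ∈ Finset.range N, g k :=
    Finset.sum_le_sum_of_subset_of_nonneg
      (Finset.range_subset_range.2 (by omega)) fun k _ _ ↦ hg k
  obtain ⟨m, rfl⟩ : ∃ m, N = i + 1 + m := ⟨N - (i + 1), by omega⟩
  rw [Finset.sum_range_add, h1]
  rw [Nat.add_sub_cancel_left] at h2
  linarith

lemma tendsto_inv_mul_sum_natAbs_sub {g : ℕ → ℝ} (hg : Summable g) :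
    Tendsto (fun N : ℕ ↦ (N : ℝ)⁻¹ *
        ∑ i ∈ Finset.range N, ∑ j ∈ Finset.range N, g ((i : ℤ) - j).natAbs)
      atTop (𝓝 (g 0 + 2 * ∑' k, g (k + 1))) := by
  simp_rw [sum_range_sum_range_natAbs_sub]
  have h := ((_root_.summable_nat_add_iff 1).2 hg).hasSum.tendsto_sum_nat
  exact ((h.const_mul 2).const_add _).cesaro

lemma tendsto_inv_sqrt_mul_sum_abs {r : ℕ → ℝ} (hr : Summable fun k ↦ r k ^ 2) :
    Tendsto (fun N : ℕ ↦ (√N)⁻¹ * ∑ k ∈ Finset.range N, |r k|) atTop (𝓝 0) := by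
  have hs : Tendsto (fun N : ℕ ↦ (√N)⁻¹) atTop (𝓝 0) :=
    tendsto_inv_atTop_zero.comp (Real.tendsto_sqrt_atTop.comp tendsto_natCast_atTop_atTop)
  rw [Metric.tendsto_atTop']
  intro ε hε
  have htail := tendsto_sum_nat_add fun k ↦ r k ^ 2
  obtain ⟨K, hK⟩ := (htail.eventually_lt_const (by positivity : 0 < (ε / 2) ^ 2)).exists
  have hA : Tendsto (fun N : ℕ ↦ (√N)⁻¹ * ∑ k ∈ Finset.range K, |r k|) atTop (𝓝 0) := by
    simpa using hs.mul_const (∑ k ∈ Finset.range K, |r k|)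
  obtain ⟨N₀, hN₀⟩ := eventually_atTop.1 (hA.eventually_lt_const (half_pos hε))
  refine ⟨max N₀ K, fun N hN ↦ ?_⟩
  have hKN : K < N := (le_max_right _ _).trans_lt hN
  have hsN : 0 < √(N : ℝ) := Real.sqrt_pos.2 (by exact_mod_cast (Nat.zero_le K).trans_lt hKN)
  rw [Real.dist_0_eq_abs, abs_of_nonneg (by positivity)]
  have h1 := hN₀ N ((le_max_left _ _).trans hN.le)
  obtain ⟨m, rfl⟩ : ∃ m, N = K + m := ⟨N - K, by omega⟩
  have h2 : ∑ k ∈ Finset.range m, |r (K + k)| ≤ √(K + m : ℕ) * (ε / 2) := by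
    refine abs_le_of_sq_le_sq' ?_ (by positivity) |>.2
    calc (∑ k ∈ Finset.range m, |r (K + k)|) ^ 2
        ≤ (Finset.range m).card * ∑ k ∈ Finset.range m, |r (K + k)| ^ 2 :=
          sq_sum_le_card_mul_sum_sq
      _ ≤ (K + m : ℕ) * (ε / 2) ^ 2 := by
          gcongr
          · simp
          · refine le_trans ?_ hK.le
            simp_rw [sq_abs, add_comm K]
            exact ((_root_.summable_nat_add_iff K).2 hr).sum_le_tsum _ fun k _ ↦ sq_nonneg _
      _ = (√(K + m : ℕ) * (ε / 2)) ^ 2 := by rw [mul_pow, Real.sq_sqrt (by positivity)]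
  rw [Finset.sum_range_add, mul_add]
  have h3 : (√(K + m : ℕ))⁻¹ * ∑ k ∈ Finset.range m, |r (K + k)| ≤ ε / 2 := by
    rw [inv_mul_le_iff₀ hsN]
    exact h2
  linarith

end Toeplitz

section PowerIncrements

lemma sum_range_rpow_increment_sq_le {a : ℝ} (ha : 0 < a) {M : ℝ} {N : ℕ}
    (hM : ∀ k < N, ((k : ℝ) + 1) ^ a - (k : ℝ) ^ a ≤ M) :
    ∑ k ∈ Finset.range N, (((k : ℝ) + 1) ^ a - (k : ℝ) ^ a) ^ 2 ≤ M * (N : ℝ) ^ a := by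
  have htel : ∑ k ∈ Finset.range N, (((k : ℝ) + 1) ^ a - (k : ℝ) ^ a) = (N : ℝ) ^ a := by
    have := Finset.sum_range_sub (fun k : ℕ ↦ (k : ℝ) ^ a) N
    simpa [Real.zero_rpow ha.ne'] using this
  rw [← htel, Finset.mul_sum]
  refine Finset.sum_le_sum fun k hk ↦ ?_
  have h0 : 0 ≤ ((k : ℝ) + 1) ^ a - (k : ℝ) ^ a :=
    sub_nonneg.2 (Real.rpow_le_rpow (by positivity) (by linarith) ha.le)
  rw [sq]
  exact mul_le_mul_of_nonneg_right (hM k (Finset.mem_range.1 hk)) h0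

lemma tendsto_sum_rpow_increment_sq {a : ℝ} (ha : 0 < a) (ha' : a < 3 / 2) :
    Tendsto (fun N : ℕ ↦ (N : ℝ) ^ (-a - 1 / 2) *
      ∑ k ∈ Finset.range N, (((k : ℝ) + 1) ^ a - (k : ℝ) ^ a) ^ 2) atTop (𝓝 0) := by
  have hz (c : ℝ) (hc : c < 0) : Tendsto (fun N : ℕ ↦ (N : ℝ) ^ c) atTop (𝓝 0) := by
    have := (tendsto_rpow_neg_atTop (neg_pos.2 hc)).comp (tendsto_natCast_atTop_atTop (R := ℝ))
    simpa [Function.comp_def] using this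
  have hlim : Tendsto (fun N : ℕ ↦ (N : ℝ) ^ (-1 / 2 : ℝ) + a * (N : ℝ) ^ (a - 3 / 2))
      atTop (𝓝 0) := by
    simpa using (hz _ (by norm_num)).add ((hz _ (by linarith)).const_mul a)
  refine squeeze_zero' (.of_forall fun N ↦ by positivity) ?_ hlim
  filter_upwards [eventually_gt_atTop 0] with N hN
  have hN' : (0 : ℝ) < N := by exact_mod_cast hN
  have hM : ∀ k < N, ((k : ℝ) + 1) ^ a - (k : ℝ) ^ a ≤ 1 + a * (N : ℝ) ^ (a - 1) := by
    intro k hk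
    rcases le_total a 1 with h1 | h1
    · have := Real.rpow_add_le_add_rpow (a := (k : ℝ)) (b := 1) (by positivity) zero_le_one
        ha.le h1
      rw [Real.one_rpow] at this
      have : 0 ≤ a * (N : ℝ) ^ (a - 1) := by positivity
      linarith
    · obtain ⟨c, hc, hc'⟩ := exists_hasDerivAt_eq_slope (fun x : ℝ ↦ x ^ a)
        (fun x ↦ a * x ^ (a - 1)) (lt_add_one (k : ℝ))
        (Real.continuous_rpow_const ha.le).continuousOn
        (fun x _ ↦ Real.hasDerivAt_rpow_const (Or.inr h1))
      rw [add_sub_cancel_left, div_one] at hc'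
      rw [← hc']
      have hkN : (k : ℝ) + 1 ≤ N := by exact_mod_cast hk
      have hc0 : 0 ≤ c := (Nat.cast_nonneg k).trans hc.1.le
      have : c ^ (a - 1) ≤ (N : ℝ) ^ (a - 1) :=
        Real.rpow_le_rpow hc0 (hc.2.le.trans hkN) (by linarith)
      have := mul_le_mul_of_nonneg_left this ha.le
      linarith
  calc (N : ℝ) ^ (-a - 1 / 2) * ∑ k ∈ Finset.range N, (((k : ℝ) + 1) ^ a - (k : ℝ) ^ a) ^ 2
      ≤ (N : ℝ) ^ (-a - 1 / 2) * ((1 + a * (N : ℝ) ^ (a - 1)) * (N : ℝ) ^ a) := by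
        gcongr
        exact sum_range_rpow_increment_sq_le ha hM
    _ = (N : ℝ) ^ (-a - 1 / 2 + a) + a * (N : ℝ) ^ (-a - 1 / 2 + (a - 1) + a) := by
        rw [Real.rpow_add hN' (-a - 1 / 2 + (a - 1)), Real.rpow_add hN' (-a - 1 / 2) (a - 1),
          Real.rpow_add hN' (-a - 1 / 2) a]
        ring
    _ = _ := by ring_nf

/-- The autocovariance at lag `k` of the increments of fractional Brownian motion over unit
intervals, with `a` twice the Hurst parameter. -/
noncomputable def fgnCov (a : ℝ) (k : ℕ) : ℝ :=
  (1 / 2) * (|(k : ℝ) + 1| ^ a + |(k : ℝ) - 1| ^ a - 2 * |(k : ℝ)| ^ a)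

lemma abs_fgnCov_add_two_le {a : ℝ} (ha' : a < 2) (k : ℕ) :
    |fgnCov a (k + 2)| ≤ |a * (a - 1)| * ((k : ℝ) + 1) ^ (a - 2) := by
  have hk : (0 : ℝ) ≤ k := Nat.cast_nonneg k
  have e : fgnCov a (k + 2) =
      (1 / 2) * ((((k : ℝ) + 2 + 1) ^ a - ((k : ℝ) + 2) ^ a) -
        (((k : ℝ) + 1 + 1) ^ a - ((k : ℝ) + 1) ^ a)) := by
    rw [fgnCov]
    push_cast
    rw [abs_of_pos (by linarith), abs_of_pos (by linarith), abs_of_pos (by linarith)]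
    ring_nf
  have hd (b x : ℝ) (hx : 0 < x) : HasDerivAt (fun x : ℝ ↦ x ^ b) (b * x ^ (b - 1)) x :=
    Real.hasDerivAt_rpow_const (Or.inl hx.ne')
  have hd1 (b x : ℝ) (hx : 0 < x) :
      HasDerivAt (fun x : ℝ ↦ (x + 1) ^ b) (b * (x + 1) ^ (b - 1)) x :=
    (hd b (x + 1) (by linarith)).comp_add_const x 1
  obtain ⟨c, hc, hc'⟩ := exists_hasDerivAt_eq_slope
    (fun x : ℝ ↦ (x + 1) ^ a - x ^ a) (fun x ↦ a * (x + 1) ^ (a - 1) - a * x ^ (a - 1))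
    (by linarith : (k : ℝ) + 1 < k + 2)
    (fun x hx ↦ ((hd1 a x (by linarith [hx.1])).sub
      (hd a x (by linarith [hx.1]))).continuousAt.continuousWithinAt)
    (fun x hx ↦ (hd1 a x (by linarith [hx.1])).sub (hd a x (by linarith [hx.1])))
  have hc0 : 0 < c := by linarith [hc.1]
  obtain ⟨d, hd0, hd'⟩ := exists_hasDerivAt_eq_slope (fun x : ℝ ↦ x ^ (a - 1))
    (fun x ↦ (a - 1) * x ^ (a - 1 - 1)) (lt_add_one c)
    (fun x hx ↦ (hd (a - 1) x (by linarith [hx.1])).continuousAt.continuousWithinAt)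
    (fun x hx ↦ hd (a - 1) x (by linarith [hx.1]))
  rw [add_sub_cancel_left, div_one] at hd'
  have e2 : (k : ℝ) + 2 - (k + 1) = 1 := by ring
  rw [e2, div_one] at hc'
  rw [e, ← hc', ← mul_sub, ← hd', ← mul_assoc a, abs_mul, abs_mul]
  have h3 : |d ^ (a - 1 - 1)| ≤ ((k : ℝ) + 1) ^ (a - 2) := by
    rw [abs_of_nonneg (Real.rpow_nonneg (by linarith [hd0.1]) _),
      show a - 1 - 1 = a - 2 by ring]
    exact Real.rpow_le_rpow_of_nonpos (by linarith) (by linarith [hd0.1, hc.1]) (by linarith)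
  have h4 : |a * (a - 1)| * |d ^ (a - 1 - 1)| ≤ |a * (a - 1)| * ((k : ℝ) + 1) ^ (a - 2) := by
    gcongr
  have h5 : |(1 / 2 : ℝ)| = 1 / 2 := abs_of_pos (by norm_num)
  rw [h5]
  have : 0 ≤ |a * (a - 1)| * |d ^ (a - 1 - 1)| := by positivity
  linarith

lemma summable_fgnCov_sq {a : ℝ} (ha' : a < 3 / 2) :
    Summable fun k ↦ fgnCov a k ^ 2 := by
  rw [← _root_.summable_nat_add_iff 2]
  have h1 : Summable fun k : ℕ ↦ |a * (a - 1)| ^ 2 * ((k : ℝ) + 1) ^ (2 * (a - 2)) := by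
    refine Summable.mul_left _ ?_
    have := (_root_.summable_nat_add_iff 1).2
      (Real.summable_nat_rpow (p := 2 * (a - 2)).2 (by linarith))
    simpa using this
  refine h1.of_nonneg_of_le (fun k ↦ sq_nonneg _) fun k ↦ ?_
  have hk : (0 : ℝ) ≤ (k : ℝ) + 1 := by positivity
  rw [← sq_abs]
  calc |fgnCov a (k + 2)| ^ 2 ≤ (|a * (a - 1)| * ((k : ℝ) + 1) ^ (a - 2)) ^ 2 := by
        gcongr
        exact abs_fgnCov_add_two_le (by linarith) k
    _ = _ := by
        rw [mul_pow, ← Real.rpow_mul_natCast hk]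
        ring_nf

end PowerIncrements

section StationaryGaussianArray

variable {Ω : Type*} [MeasurableSpace Ω] {P : Measure Ω}
  {X : ∀ N : ℕ, Fin N → Ω → ℝ} {r : ℕ → ℝ}

/-- The normalized centered sums of squares of a triangular array of stationary Gaussian vectors
with square-summable covariances are asymptotically normal. -/
lemma tendstoInDistribution_sum_sq_sub_of_stationary [IsProbabilityMeasure P]
    (hX : ∀ N, HasGaussianLaw (fun ω i ↦ X N i ω) P) (h0 : ∀ N i, ∫ ω, X N i ω ∂P = 0)
    (hC : ∀ N i j, ∫ ω, X N i ω * X N j ω ∂P = r ((i : ℤ) - j).natAbs)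
    (hr : Summable fun k ↦ r k ^ 2) (c : ℝ) {v : ℝ≥0}
    (hv : (v : ℝ) = 2 * c ^ 2 * (r 0 ^ 2 + 2 * ∑' k, r (k + 1) ^ 2)) :
    TendstoInDistribution (fun (N : ℕ) ω ↦ c * (√N)⁻¹ * ∑ i, (X N i ω ^ 2 - r 0)) atTop id
      (fun _ ↦ P) (gaussianReal 0 v) := by
  have hXm (N : ℕ) (i : Fin N) : AEMeasurable (X N i) P :=
    (measurable_pi_apply i).comp_aemeasurable (hX N).aemeasurable
  have hm (N : ℕ) : AEMeasurable (fun ω ↦ ∑ i, (X N i ω ^ 2 - r 0)) P :=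
    Finset.aemeasurable_fun_sum _ fun i _ ↦ ((hXm N i).pow_const 2).sub_const _
  refine ⟨fun N ↦ (hm N).const_mul _, aemeasurable_id, ?_⟩
  refine ProbabilityMeasure.tendsto_iff_tendsto_charFun.2 fun t ↦ ?_
  let C (N : ℕ) : Matrix (Fin N) (Fin N) ℝ := Matrix.of fun i j ↦ r ((i : ℤ) - j).natAbs
  have hH (N : ℕ) : (C N).IsHermitian := by
    refine Matrix.IsHermitian.ext fun i j ↦ ?_
    simp only [C, Matrix.of_apply, star_trivial]
    congr 1
    omega
  have hchar (N : ℕ) : charFun (P.map fun ω ↦ c * (√N)⁻¹ * ∑ i, (X N i ω ^ 2 - r 0)) t =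
      ∏ i, centeredSqCharFun (t * (c * (√N)⁻¹) * (hH N).eigenvalues i) := by
    have h := charFun_map_sum_sq_sub (hX N) (h0 N) (C := C N) (fun i j ↦ hC N i j) (hH N)
      (t * (c * (√N)⁻¹))
    have hd (i : Fin N) : C N i i = r 0 := by simp [C]
    simp_rw [hd] at h
    rw [← h, mul_comm t, ← charFun_map_mul_comp (hm N)]
  have hlim := tendsto_prod_centeredSqCharFun
    (fun N i ↦ t * (c * (√N)⁻¹) * (hH N).eigenvalues i)
    (fun N ↦ |t * c| * (2 * ((√N)⁻¹ * ∑ k ∈ Finset.range N, |r k|)))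
    (by simpa using ((tendsto_inv_sqrt_mul_sum_abs hr).const_mul 2).const_mul |t * c|)
    (fun N i ↦ ?_) (V := t ^ 2 * c ^ 2 * (r 0 ^ 2 + 2 * ∑' k, r (k + 1) ^ 2)) ?_
  · convert hlim using 2 with N
    · exact hchar N
    · simp only [ProbabilityMeasure.coe_mk, Measure.map_id, charFun_gaussianReal]
      congr 1
      have : (v : ℂ) = ((v : ℝ) : ℂ) := rfl
      rw [this, hv]
      push_cast
      ring
  · have := abs_eigenvalues_le (hH N) (M := 2 * ∑ k ∈ Finset.range N, |r k|) (fun i ↦ ?_) i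
    · rw [abs_mul, ← mul_assoc t, abs_mul, abs_of_nonneg (a := (√(N : ℝ))⁻¹) (by positivity)]
      calc _ ≤ |t * c| * (√N)⁻¹ * (2 * ∑ k ∈ Finset.range N, |r k|) := by gcongr
        _ = _ := by ring
    · have := sum_range_natAbs_sub_le (g := fun k ↦ |r k|) (fun k ↦ abs_nonneg _) i.2
      rwa [Finset.sum_range] at this
  · have h := (tendsto_inv_mul_sum_natAbs_sub (g := fun k ↦ r k ^ 2) hr).const_mul (t ^ 2 * c ^ 2)
    refine h.congr fun N ↦ ?_
    simp_rw [mul_pow, inv_pow, Real.sq_sqrt (Nat.cast_nonneg N)]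
    rw [← Finset.mul_sum, sum_eigenvalues_sq, Finset.sum_range]
    simp_rw [Finset.sum_range, C, Matrix.of_apply]
    ring

/-- Normalized weighted sums of a triangular array of stationary Gaussian vectors with
square-summable covariances vanish asymptotically if the squares of the weights do. -/
lemma tendstoInMeasure_weighted_sum_of_stationary
    (hX : ∀ N i, MemLp (X N i) 2 P)
    (hC : ∀ N i j, ∫ ω, X N i ω * X N j ω ∂P = r ((i : ℤ) - j).natAbs)
    (hr : Summable fun k ↦ r k ^ 2) {w : ∀ N : ℕ, Fin N → ℝ}
    (hw : Tendsto (fun N : ℕ ↦ (√N)⁻¹ * ∑ i, w N i ^ 2) atTop (𝓝 0)) (c : ℝ) :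
    TendstoInMeasure P (fun (N : ℕ) ω ↦ c * (√N)⁻¹ * ∑ i, w N i * X N i ω) atTop (fun _ ↦ 0) := by
  have hL (N : ℕ) : MemLp (fun ω ↦ c * (√N)⁻¹ * ∑ i, w N i * X N i ω) 2 P :=
    (memLp_finsetSum _ fun i _ ↦ (hX N i).const_mul (w N i)).const_mul _
  refine tendstoInMeasure_of_tendsto_eLpNorm (p := 2) (by norm_num) (fun N ↦ (hL N).1)
    aestronglyMeasurable_const ?_
  have hint : Tendsto (fun N : ℕ ↦ ∫ ω, (c * (√N)⁻¹ * ∑ i, w N i * X N i ω) ^ 2 ∂P) atTop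
      (𝓝 0) := by
    have hlim : Tendsto (fun N : ℕ ↦ c ^ 2 * (((√N)⁻¹ * ∑ i, w N i ^ 2) *
        (2 * ((√N)⁻¹ * ∑ k ∈ Finset.range N, |r k|)))) atTop (𝓝 0) := by
      simpa using (hw.mul ((tendsto_inv_sqrt_mul_sum_abs hr).const_mul 2)).const_mul (c ^ 2)
    refine squeeze_zero (fun N ↦ integral_nonneg fun ω ↦ sq_nonneg _) (fun N ↦ ?_) hlim
    have h1 : ∫ ω, (c * (√N)⁻¹ * ∑ i, w N i * X N i ω) ^ 2 ∂P =
        (c * (√N)⁻¹) ^ 2 * ∑ i, ∑ j, w N i * w N j * r ((i : ℤ) - j).natAbs := by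
      simp_rw [mul_pow _ (∑ i, _), integral_const_mul, sq (∑ i, _)]
      rw [integral_sum_mul_sum (C := fun i j : Fin N ↦ r ((i : ℤ) - j).natAbs) (hX N) (hC N)]
    have hrow (i : Fin N) : ∑ j : Fin N, |r ((i : ℤ) - j).natAbs| ≤
        2 * ∑ k ∈ Finset.range N, |r k| := by
      have := sum_range_natAbs_sub_le (g := fun k ↦ |r k|) (fun k ↦ abs_nonneg _) i.2
      rwa [Finset.sum_range] at this
    have h2 : ∑ i, ∑ j, w N i * w N j * r ((i : ℤ) - j).natAbs ≤
        (∑ i, w N i ^ 2) * (2 * ∑ k ∈ Finset.range N, |r k|) := by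
      calc ∑ i, ∑ j, w N i * w N j * r ((i : ℤ) - j).natAbs
          ≤ ∑ i : Fin N, ∑ j : Fin N, (1 / 2 * (w N i ^ 2 * |r ((i : ℤ) - j).natAbs|) +
              1 / 2 * (w N j ^ 2 * |r ((j : ℤ) - i).natAbs|)) := by
            refine Finset.sum_le_sum fun i _ ↦ Finset.sum_le_sum fun j _ ↦ ?_
            rw [show ((j : ℤ) - i).natAbs = ((i : ℤ) - j).natAbs by omega]
            have h3 : w N i * w N j * r ((i : ℤ) - j).natAbs ≤
                |w N i * w N j| * |r ((i : ℤ) - j).natAbs| := by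
              rw [← abs_mul]
              exact le_abs_self _
            have h4 : |w N i * w N j| ≤ 1 / 2 * (w N i ^ 2 + w N j ^ 2) := by
              rw [abs_le]
              constructor <;> nlinarith [sq_nonneg (w N i - w N j), sq_nonneg (w N i + w N j)]
            nlinarith [mul_le_mul_of_nonneg_right h4 (abs_nonneg (r ((i : ℤ) - j).natAbs))]
        _ = ∑ i : Fin N, ∑ j : Fin N, w N i ^ 2 * |r ((i : ℤ) - j).natAbs| := by
            simp_rw [Finset.sum_add_distrib]
            rw [Finset.sum_comm (f := fun i j : Fin N ↦
              1 / 2 * (w N j ^ 2 * |r ((j : ℤ) - i).natAbs|))]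
            simp_rw [← Finset.mul_sum]
            ring
        _ ≤ _ := by
            rw [Finset.sum_mul]
            refine Finset.sum_le_sum fun i _ ↦ ?_
            rw [← Finset.mul_sum]
            exact mul_le_mul_of_nonneg_left (hrow i) (sq_nonneg _)
    rw [h1]
    calc _ ≤ (c * (√N)⁻¹) ^ 2 * ((∑ i, w N i ^ 2) * (2 * ∑ k ∈ Finset.range N, |r k|)) := by
          gcongr
      _ = _ := by ring
  have he (N : ℕ) : eLpNorm ((fun ω ↦ c * (√N)⁻¹ * ∑ i, w N i * X N i ω) - fun _ ↦ 0) 2 P =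
      ENNReal.ofReal ((∫ ω, (c * (√N)⁻¹ * ∑ i, w N i * X N i ω) ^ 2 ∂P) ^ (2⁻¹ : ℝ)) := by
    have : ((fun ω ↦ c * (√N)⁻¹ * ∑ i, w N i * X N i ω) - fun _ ↦ (0 : ℝ)) =
        fun ω ↦ c * (√N)⁻¹ * ∑ i, w N i * X N i ω := by
      ext ω
      simp
    rw [this, (hL N).eLpNorm_eq_integral_rpow_norm (by norm_num) (by norm_num)]
    simp [mul_pow]
  simp_rw [he]
  have := ENNReal.tendsto_ofReal (hint.rpow_const (p := 2⁻¹) (Or.inr (by norm_num)))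
  simpa using this

end StationaryGaussianArray

section FractionalBrownianMotion

variable {Ω : Type*} [MeasurableSpace Ω] {P : Measure Ω} {B : ℝ → Ω → ℝ}

lemma hasGaussianLaw_of_forall_sum
    (hGauss : ∀ (n : ℕ) (a : Fin n → ℝ) (t : Fin n → ℝ), (∀ i, 0 ≤ t i) →
      ∃ v : ℝ≥0, P.map (fun ω => ∑ i, a i * B (t i) ω) = gaussianReal 0 v)
    {n : ℕ} {t : Fin n → ℝ} (ht : ∀ i, 0 ≤ t i) :
    HasGaussianLaw (fun ω i ↦ B (t i) ω) P ∧ ∀ i, ∫ ω, B (t i) ω ∂P = 0 := by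
  have h1 (i : Fin n) : ∃ v : ℝ≥0, P.map (B (t i)) = gaussianReal 0 v := by
    obtain ⟨v, hv⟩ := hGauss 1 (fun _ ↦ 1) (fun _ ↦ t i) fun _ ↦ ht i
    exact ⟨v, by simpa using hv⟩
  have hm (i : Fin n) : AEMeasurable (B (t i)) P := by
    obtain ⟨v, hv⟩ := h1 i
    refine AEMeasurable.of_map_ne_zero ?_
    rw [hv]
    exact (inferInstance : IsProbabilityMeasure (gaussianReal 0 v)).ne_zero
  refine ⟨⟨isGaussian_of_map_eq_gaussianReal fun L ↦ ?_⟩, fun i ↦ ?_⟩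
  · obtain ⟨v, hv⟩ := hGauss n (fun i ↦ L (Pi.single i 1)) t ht
    refine ⟨0, v, ?_⟩
    rw [AEMeasurable.map_map_of_aemeasurable (by fun_prop) (aemeasurable_pi_lambda _ hm), ← hv]
    congr 1
    ext ω
    rw [Function.comp_apply, ← L.sum_comp_single]
    refine Finset.sum_congr rfl fun i _ ↦ ?_
    have := (L.comp (ContinuousLinearMap.single ℝ (fun _ : Fin n ↦ ℝ) i)).map_smul (B (t i) ω) 1
    simpa [mul_comm] using this
  · obtain ⟨v, hv⟩ := h1 i
    have := integral_map (hm i) (f := id) (by fun_prop)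
    rw [hv] at this
    simpa using this.symm

/-- The rescaled increments of a process `B` over the grid of mesh `1 / N`. -/
noncomputable def scaledIncrement (B : ℝ → Ω → ℝ) (H : ℝ) (N : ℕ) (i : Fin N) (ω : Ω) : ℝ :=
  (N : ℝ) ^ H * (B (((i : ℝ) + 1) / N) ω - B ((i : ℝ) / N) ω)

lemma hasGaussianLaw_scaledIncrement
    (hGauss : ∀ (n : ℕ) (a : Fin n → ℝ) (t : Fin n → ℝ), (∀ i, 0 ≤ t i) →
      ∃ v : ℝ≥0, P.map (fun ω => ∑ i, a i * B (t i) ω) = gaussianReal 0 v) (H : ℝ) (N : ℕ) :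
    HasGaussianLaw (fun ω i ↦ scaledIncrement B H N i ω) P := by
  have h := (hasGaussianLaw_of_forall_sum hGauss (t := fun i : Fin (N + 1) ↦ (i : ℝ) / N)
    fun i ↦ by positivity).1
  have := h.map_fun (ContinuousLinearMap.pi fun i : Fin N ↦ (N : ℝ) ^ H •
    (ContinuousLinearMap.proj (R := ℝ) (φ := fun _ : Fin (N + 1) ↦ ℝ) i.succ -
      ContinuousLinearMap.proj (R := ℝ) (φ := fun _ : Fin (N + 1) ↦ ℝ) i.castSucc))
  refine this.congr (.of_forall fun ω ↦ ?_)
  ext i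
  simp [scaledIncrement]

lemma integral_scaledIncrement
    (hGauss : ∀ (n : ℕ) (a : Fin n → ℝ) (t : Fin n → ℝ), (∀ i, 0 ≤ t i) →
      ∃ v : ℝ≥0, P.map (fun ω => ∑ i, a i * B (t i) ω) = gaussianReal 0 v)
    (H : ℝ) (N : ℕ) (i : Fin N) :
    ∫ ω, scaledIncrement B H N i ω ∂P = 0 := by
  obtain ⟨h1, h2⟩ := hasGaussianLaw_of_forall_sum hGauss (t := fun i : Fin (N + 1) ↦ (i : ℝ) / N)
    fun i ↦ by positivity
  have hi (j : Fin (N + 1)) : Integrable (fun ω ↦ B ((j : ℝ) / N) ω) P :=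
    h1.integrable.eval j
  have ha := h2 i.succ
  have hb := h2 i.castSucc
  have hia := hi i.succ
  have hib := hi i.castSucc
  simp only [Fin.val_succ, Nat.cast_add, Nat.cast_one, Fin.val_castSucc] at ha hb hia hib
  simp only [scaledIncrement]
  rw [integral_const_mul, integral_sub hia hib, ha, hb]
  simp

lemma integral_scaledIncrement_mul
    (hGauss : ∀ (n : ℕ) (a : Fin n → ℝ) (t : Fin n → ℝ), (∀ i, 0 ≤ t i) →
      ∃ v : ℝ≥0, P.map (fun ω => ∑ i, a i * B (t i) ω) = gaussianReal 0 v) {H : ℝ}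
    (hCov : ∀ s t : ℝ, 0 ≤ s → 0 ≤ t →
      ∫ ω, B s ω * B t ω ∂P = (1/2) * (s ^ (2*H) + t ^ (2*H) - |t - s| ^ (2*H)))
    (N : ℕ) (i j : Fin N) :
    ∫ ω, scaledIncrement B H N i ω * scaledIncrement B H N j ω ∂P =
      fgnCov (2 * H) ((i : ℤ) - j).natAbs := by
  have hN : (0 : ℝ) < N := by exact_mod_cast i.pos
  obtain ⟨h1, -⟩ := hasGaussianLaw_of_forall_sum hGauss (t := fun i : Fin (N + 1) ↦ (i : ℝ) / N)
    fun i ↦ by positivity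
  have hL (j : Fin (N + 1)) : MemLp (fun ω ↦ B ((j : ℝ) / N) ω) 2 P :=
    h1.memLp_two.eval j
  have hs (i : Fin N) : MemLp (fun ω ↦ B (((i : ℝ) + 1) / N) ω) 2 P := by
    simpa using hL i.succ
  have hc (i : Fin N) : MemLp (fun ω ↦ B ((i : ℝ) / N) ω) 2 P := by
    simpa using hL i.castSucc
  have hsq : ((N : ℝ) ^ H) * ((N : ℝ) ^ H) = (N : ℝ) ^ (2 * H) := by
    rw [← Real.rpow_add hN, two_mul]
  have hdiv (x : ℝ) : (N : ℝ) ^ (2 * H) * |x / N| ^ (2 * H) = |x| ^ (2 * H) := by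
    rw [abs_div, Real.div_rpow (abs_nonneg _) (abs_nonneg _), abs_of_pos hN,
      mul_div_cancel₀ _ (Real.rpow_pos_of_pos hN _).ne']
  have hexp : ∫ ω, scaledIncrement B H N i ω * scaledIncrement B H N j ω ∂P =
      (N : ℝ) ^ (2 * H) *
        (((∫ ω, B (((i : ℝ) + 1) / N) ω * B (((j : ℝ) + 1) / N) ω ∂P) -
          ∫ ω, B (((i : ℝ) + 1) / N) ω * B ((j : ℝ) / N) ω ∂P) -
        ((∫ ω, B ((i : ℝ) / N) ω * B (((j : ℝ) + 1) / N) ω ∂P) -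
          ∫ ω, B ((i : ℝ) / N) ω * B ((j : ℝ) / N) ω ∂P)) := by
    have hi {f g : Ω → ℝ} (hf : MemLp f 2 P) (hg : MemLp g 2 P) :
        Integrable (fun ω ↦ f ω * g ω) P := hf.integrable_mul hg
    have hi2 (i : Fin N) {f : Ω → ℝ} (hf : MemLp f 2 P) : Integrable
        (fun ω ↦ f ω * B (((i : ℝ) + 1) / N) ω - f ω * B ((i : ℝ) / N) ω) P :=
      (hi hf (hs i)).sub (hi hf (hc i))
    rw [← integral_sub (hi (hs i) (hs j)) (hi (hs i) (hc j)),
      ← integral_sub (hi (hc i) (hs j)) (hi (hc i) (hc j)),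
      ← integral_sub (hi2 j (hs i)) (hi2 j (hc i)), ← integral_const_mul]
    refine integral_congr_ae (.of_forall fun ω ↦ ?_)
    simp only [scaledIncrement]
    rw [← hsq]
    ring
  rw [hexp, hCov _ _ (by positivity) (by positivity), hCov _ _ (by positivity) (by positivity),
    hCov _ _ (by positivity) (by positivity), hCov _ _ (by positivity) (by positivity)]
  have hd : |(((i : ℤ) - j).natAbs : ℝ)| = |(i : ℝ) - j| := by
    rw [Nat.cast_natAbs]
    push_cast
    rw [abs_abs]
  have hpm : |(((i : ℤ) - j).natAbs : ℝ) + 1| ^ (2 * H) +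
        |(((i : ℤ) - j).natAbs : ℝ) - 1| ^ (2 * H) =
      |(i : ℝ) - j + 1| ^ (2 * H) + |(i : ℝ) - j - 1| ^ (2 * H) := by
    rw [Nat.cast_natAbs]
    push_cast
    rcases abs_cases ((i : ℝ) - j) with ⟨h, -⟩ | ⟨h, -⟩ <;> rw [h]
    rw [← abs_neg, ← abs_neg (-((i : ℝ) - j) - 1), add_comm]
    ring_nf
  have hd1 : |((j : ℝ) + 1) / N - ((i : ℝ) + 1) / N| = |((i : ℝ) - j) / N| := by
    rw [abs_sub_comm]
    ring_nf
  have hd2 : |(j : ℝ) / N - ((i : ℝ) + 1) / N| = |((i : ℝ) - j + 1) / N| := by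
    rw [abs_sub_comm]
    ring_nf
  have hd3 : |((j : ℝ) + 1) / N - (i : ℝ) / N| = |((i : ℝ) - j - 1) / N| := by
    rw [abs_sub_comm]
    ring_nf
  have hd4 : |(j : ℝ) / N - (i : ℝ) / N| = |((i : ℝ) - j) / N| := by
    rw [abs_sub_comm]
    ring_nf
  rw [fgnCov, hpm, hd, ← hdiv ((i : ℝ) - j + 1), ← hdiv ((i : ℝ) - j - 1), ← hdiv ((i : ℝ) - j),
    hd1, hd2, hd3, hd4]
  ring

end FractionalBrownianMotion

/-- The normalized error of the quadratic-variation estimator is a centered quadratic form in the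
rescaled increments plus terms coming from the drift. -/
lemma sqrt_mul_sum_sq_log_increment_sub {Ω : Type*} {B : ℝ → Ω → ℝ} {H σ S₀ : ℝ} (hS₀ : 0 < S₀)
    {S : ℝ → Ω → ℝ}
    (hS : ∀ t ω, S t ω = S₀ * Real.exp (σ * B t ω - (1/2) * σ^2 * t ^ (2*H))) (N : ℕ) (ω : Ω) :
    √N * ((N : ℝ) ^ (2*H - 1) * ∑ k ∈ Finset.range N,
        (Real.log (S (((k : ℝ) + 1)/N) ω) - Real.log (S ((k : ℝ)/N) ω))^2 - σ ^ 2) =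
      σ ^ 2 * (√N)⁻¹ * ∑ i, (scaledIncrement B H N i ω ^ 2 - 1) +
      -σ ^ 3 * (√N)⁻¹ * ∑ i : Fin N, ((N : ℝ) ^ H)⁻¹ *
        (((i : ℝ) + 1) ^ (2 * H) - (i : ℝ) ^ (2 * H)) * scaledIncrement B H N i ω +
      σ ^ 4 / 4 * ((√N)⁻¹ * ∑ i : Fin N, (((N : ℝ) ^ H)⁻¹ *
        (((i : ℝ) + 1) ^ (2 * H) - (i : ℝ) ^ (2 * H))) ^ 2) := by
  rcases N.eq_zero_or_pos with rfl | hN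
  · simp
  have hN' : (0 : ℝ) < N := by exact_mod_cast hN
  have hlog (t : ℝ) : Real.log (S t ω) =
      Real.log S₀ + (σ * B t ω - (1/2) * σ^2 * t ^ (2*H)) := by
    rw [hS, Real.log_mul hS₀.ne' (Real.exp_pos _).ne', Real.log_exp]
  have hc : 0 < (N : ℝ) ^ H := Real.rpow_pos_of_pos hN' _
  have h2 : (N : ℝ) ^ (2 * H) = (N : ℝ) ^ H * (N : ℝ) ^ H := by
    rw [← Real.rpow_add hN', two_mul]
  have hs : 0 < √(N : ℝ) := Real.sqrt_pos.2 hN'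
  have hsum : ∑ i : Fin N, σ ^ 2 = N * σ ^ 2 := by simp
  rw [Real.rpow_sub_one hN'.ne', h2, Finset.sum_range, Finset.mul_sum]
  have hterm (i : Fin N) : (N : ℝ) ^ H * (N : ℝ) ^ H / N *
      (Real.log (S (((i : ℝ) + 1)/N) ω) - Real.log (S ((i : ℝ)/N) ω))^2 =
      (N : ℝ)⁻¹ * (σ ^ 2 * (scaledIncrement B H N i ω ^ 2 - 1) + σ ^ 2 +
        -σ ^ 3 * (((N : ℝ) ^ H)⁻¹ * (((i : ℝ) + 1) ^ (2 * H) - (i : ℝ) ^ (2 * H)) *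
          scaledIncrement B H N i ω) +
        σ ^ 4 / 4 * (((N : ℝ) ^ H)⁻¹ * (((i : ℝ) + 1) ^ (2 * H) - (i : ℝ) ^ (2 * H))) ^ 2) := by
    rw [hlog, hlog, Real.div_rpow (by positivity) hN'.le, Real.div_rpow (by positivity) hN'.le,
      h2, scaledIncrement]
    field_simp
    ring
  simp_rw [hterm]
  rw [← Finset.mul_sum, Finset.sum_add_distrib, Finset.sum_add_distrib, Finset.sum_add_distrib,
    hsum, ← Finset.mul_sum, ← Finset.mul_sum, ← Finset.mul_sum]
  have hu : √(N : ℝ) * (N : ℝ)⁻¹ = (√N)⁻¹ := by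
    rw [← div_eq_mul_inv, Real.sqrt_div_self]
  rw [mul_sub, ← mul_assoc, hu, show √(N : ℝ) * σ ^ 2 = (√N)⁻¹ * (N * σ ^ 2) by
    rw [← hu]
    field_simp]
  ring

/-- Central limit theorem for the quadratic-variation volatility
estimator for a geometric fractional Brownian motion with constant volatility. -/
theorem clt_quadratic_variation_constant_vol
    {Ω : Type*} [MeasurableSpace Ω] (P : Measure Ω) [IsProbabilityMeasure P]
    (H : ℝ) (hH : H ∈ Set.Ioo (0 : ℝ) (3/4))
    (B : ℝ → Ω → ℝ)
    -- every finite linear combination of the B^H_{t_i} is a centered Gaussian r.v.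
    (hGauss : ∀ (n : ℕ) (a : Fin n → ℝ) (t : Fin n → ℝ), (∀ i, 0 ≤ t i) →
      ∃ v : ℝ≥0, P.map (fun ω => ∑ i, a i * B (t i) ω) = gaussianReal 0 v)
    -- fBm covariance
    (hCov : ∀ s t : ℝ, 0 ≤ s → 0 ≤ t →
      ∫ ω, B s ω * B t ω ∂P = (1/2) * (s ^ (2*H) + t ^ (2*H) - |t - s| ^ (2*H)))
    (σ S₀ : ℝ) (hσ : 0 < σ) (hS₀ : 0 < S₀)
    (S : ℝ → Ω → ℝ)
    (hS : ∀ t ω, S t ω = S₀ * Real.exp (σ * B t ω - (1/2) * σ^2 * t ^ (2*H)))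
    -- the quadratic-variation estimator
    (σhat : ℕ → Ω → ℝ)
    (hσhat : ∀ (N : ℕ) (ω : Ω), σhat N ω = (N : ℝ) ^ (2*H - 1) *
      ∑ k ∈ Finset.range N,
        (Real.log (S (((k : ℝ) + 1)/N) ω) - Real.log (S ((k : ℝ)/N) ω))^2)
    -- the autocovariance function ρ_H of the increments
    (ρ : ℕ → ℝ)
    (hρ : ∀ k : ℕ, ρ k =
      (1/2) * (((k : ℝ) + 1) ^ (2*H) + ((k : ℝ) - 1) ^ (2*H) - 2 * (k : ℝ) ^ (2*H)))
    -- the limiting variance σ²_{H,2}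
    (v : ℝ≥0)
    (hv : (v : ℝ) = 2 * σ^4 * (1 + 2 * ∑' k : ℕ, ρ (k + 1) ^ 2)) :
    -- conclusion: √N (σ̂²_N − σ²) ⇒ N(0, σ²_{H,2})
    ∀ f : ℝ →ᵇ ℝ,
      Tendsto (fun N : ℕ =>
          ∫ ω, f (Real.sqrt N * (σhat N ω - σ^2)) ∂P)
        atTop (𝓝 (∫ x, f x ∂(gaussianReal 0 v))) := by
  have ha : 0 < 2 * H := by linarith [hH.1]
  have ha' : 2 * H < 3 / 2 := by linarith [hH.2]
  have hr0 : fgnCov (2 * H) 0 = 1 := by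
    simp [fgnCov, Real.zero_rpow ha.ne']
    norm_num
  have hrk (k : ℕ) : fgnCov (2 * H) (k + 1) = ρ (k + 1) := by
    rw [hρ, fgnCov, abs_of_nonneg (by positivity), abs_of_nonneg (by simp),
      abs_of_nonneg (by positivity)]
  have hsum := summable_fgnCov_sq ha'
  have hX := hasGaussianLaw_scaledIncrement hGauss H
  have hC := integral_scaledIncrement_mul hGauss hCov
  have hmain := tendstoInDistribution_sum_sq_sub_of_stationary hX
    (integral_scaledIncrement hGauss H) hC hsum (σ ^ 2) (v := v) (by
      simp_rw [hrk, hr0, hv]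
      ring)
  let w (N : ℕ) (i : Fin N) : ℝ :=
    ((N : ℝ) ^ H)⁻¹ * (((i : ℝ) + 1) ^ (2 * H) - (i : ℝ) ^ (2 * H))
  have hw : Tendsto (fun N : ℕ ↦ (√N)⁻¹ * ∑ i, w N i ^ 2) atTop (𝓝 0) := by
    refine (tendsto_sum_rpow_increment_sq ha ha').congr' ?_
    filter_upwards [eventually_gt_atTop 0] with N hN
    have hN' : (0 : ℝ) < N := by exact_mod_cast hN
    simp_rw [w, mul_pow]
    rw [← Finset.mul_sum, ← mul_assoc, Finset.sum_range, Real.sqrt_eq_rpow, ← Real.rpow_neg hN'.le,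
      ← Real.rpow_neg hN'.le, ← Real.rpow_mul_natCast hN'.le, ← Real.rpow_add hN']
    congr 2
    push_cast
    ring
  have hcross := tendstoInMeasure_weighted_sum_of_stationary
    (fun N i ↦ (hX N).memLp_two.eval i) hC hsum hw (-σ ^ 3)
  have hdrift : TendstoInMeasure P
      (fun (N : ℕ) (_ : Ω) ↦ σ ^ 4 / 4 * ((√N)⁻¹ * ∑ i, w N i ^ 2)) atTop (fun _ ↦ 0) :=
    tendstoInMeasure_of_tendsto_ae (fun _ ↦ aestronglyMeasurable_const)
      (.of_forall fun _ ↦ by simpa using hw.const_mul (σ ^ 4 / 4))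
  have hXm (N : ℕ) (i : Fin N) : AEMeasurable (scaledIncrement B H N i) P :=
    (measurable_pi_apply i).comp_aemeasurable (hX N).aemeasurable
  have hlim := (hmain.add_of_tendstoInMeasure_const hcross fun N ↦
    (Finset.aemeasurable_fun_sum _ fun i _ ↦ (hXm N i).const_mul (w N i)).const_mul _)
      |>.add_of_tendstoInMeasure_const hdrift fun N ↦ aemeasurable_const
  intro f
  have hf := ProbabilityMeasure.tendsto_iff_forall_integral_tendsto.1 hlim.tendsto f
  have hZ (N : ℕ) : (fun ω ↦ √N * (σhat N ω - σ ^ 2)) =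
      (fun ω ↦ σ ^ 2 * (√N)⁻¹ * ∑ i, (scaledIncrement B H N i ω ^ 2 - fgnCov (2 * H) 0)) +
      (fun ω ↦ -σ ^ 3 * (√N)⁻¹ * ∑ i, w N i * scaledIncrement B H N i ω) +
      fun ω ↦ σ ^ 4 / 4 * ((√N)⁻¹ * ∑ i, w N i ^ 2) := by
    ext ω
    rw [hσhat, hr0]
    exact sqrt_mul_sum_sq_log_increment_sub hS₀ hS N ω
  refine (hf.congr fun N ↦ ?_).trans_eq ?_
  · rw [ProbabilityMeasure.coe_mk, integral_map (hlim.forall_aemeasurable N)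
      f.continuous.aestronglyMeasurable, ← hZ]
  · rw [ProbabilityMeasure.coe_mk, integral_map hlim.aemeasurable_limit
      f.continuous.aestronglyMeasurable]
    simp
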